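/- Let M be a positive integer that has at least two distinct partitions into triples of positive integers with equal product N. Then N is not a prime power: there is no prime p and positive integer r with N = p^r. -/

import Mathlib

theorem sort3 (a b c : ℕ) : ∃ x y z : ℕ, x ≤ y ∧ y ≤ z ∧ x + y + z = a + b + c ∧
    x * y * z = a * b * c ∧ ({x, y, z} : Multiset ℕ) = {a, b, c} := by
  have sw1 : ∀ a b c : ℕ, ({a, b, c} : Multiset ℕ) = {b, a, c} := fun a b c =>
    Multiset.cons_swap a b {c}
  have sw2 : ∀ a b c : ℕ, ({a, b, c} : Multiset ℕ) = {a, c, b} := fun a b c =>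
    congrArg (Multiset.cons a) (Multiset.cons_swap b c 0)
  rcases le_total a b with h1 | h1 <;> rcases le_total b c with h2 | h2 <;>
    rcases le_total a c with h3 | h3
  · exact ⟨a, b, c, h1, h2, rfl, rfl, rfl⟩
  · exact ⟨a, b, c, h1, h2, rfl, rfl, rfl⟩
  · exact ⟨a, c, b, h3, h2, by ring, by ring, sw2 _ _ _⟩
  · exact ⟨c, a, b, h3, h1, by ring, by ring, by rw [sw1, sw2]⟩
  · exact ⟨b, a, c, h1, h3, by ring, by ring, sw1 _ _ _⟩
  · exact ⟨b, c, a, h2, h3, by ring, by ring, by rw [sw2, sw1]⟩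
  · exact ⟨c, b, a, h2, h1, by ring, by ring, by rw [sw1, sw2, sw1]⟩
  · exact ⟨c, b, a, h2, h1, by ring, by ring, by rw [sw1, sw2, sw1]⟩

theorem largest_part_le (a b c d e f : ℕ) (hd : 0 < d) (he : 0 < e) (hc : 0 < c)
    (h1 : a ≤ b) (h2 : b ≤ c) (hs : a + b + c = d + e + f) (hp : a * b * c = d * e * f)
    (hbc : b ∣ c ∨ c ∣ b) (hcf : c ∣ f ∨ f ∣ c) (hf : 0 < f) : f ≤ c := by
  by_contra hlt
  push Not at hlt
  have hdv : c ∣ f := by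
    rcases hcf with h | h
    · exact h
    · exact absurd (Nat.le_of_dvd hc h) (by omega)
  obtain ⟨k, rfl⟩ := hdv
  have hk3 : k < 3 := by
    by_contra hk
    have : c * 3 ≤ c * k := Nat.mul_le_mul_left c (by omega)
    omega
  have hk : k = 2 := by interval_cases k <;> omega
  subst hk
  have hbc' : b = c := by
    rcases hbc with ⟨j, hj⟩ | h
    · by_contra hne
      have : 2 ≤ j := by
        by_contra hj2
        have hj2 : j < 2 := by omega
        interval_cases j <;> omega
      have : b * 2 ≤ b * j := Nat.mul_le_mul_left b this
      omega
    · rcases Nat.eq_zero_or_pos b with h0 | h0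
      · omega
      · exact le_antisymm h2 (Nat.le_of_dvd h0 h)
  subst hbc'
  have ha : a = d + e := by omega
  have h3 : a * b = 2 * (d * e) := by
    apply Nat.eq_of_mul_eq_mul_right hc
    linarith
  subst ha
  nlinarith [Nat.mul_le_mul_left (d + e) h1, Nat.mul_pos hd hd, Nat.mul_pos he he]

theorem pair_not_lt (x y u v : ℕ) (huv : u ≤ v) (hs : x + y = u + v) (hq : x * y = u * v) :
    ¬ x < u := by
  intro h
  obtain ⟨t, rfl⟩ := Nat.exists_eq_add_of_lt h
  have hy : y = v + t + 1 := by omega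
  subst hy
  have h1 : (t + 1) * x = (t + 1) * v := by linarith
  have h2 := Nat.eq_of_mul_eq_mul_left (Nat.succ_pos t) h1
  omega

/-- If a positive integer `M` has two distinct partitions into triples of
positive integers with equal product `N`, then `N` is not a prime power. -/
theorem not_prime_pow_of_two_partitions
    (M N a b c d e f : ℕ) (hM : 0 < M) (hN : 0 < N)
    (ha : 0 < a) (hb : 0 < b) (hc : 0 < c) (hd : 0 < d) (he : 0 < e) (hf : 0 < f)
    (hsum1 : a + b + c = M) (hsum2 : d + e + f = M)
    (hprod1 : a * b * c = N) (hprod2 : d * e * f = N)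
    (hdistinct : ({a, b, c} : Multiset ℕ) ≠ {d, e, f}) :
    ¬ ∃ (p r : ℕ), p.Prime ∧ 0 < r ∧ N = p ^ r := by
  rintro ⟨p, r, hpp, hr, hpr⟩
  apply hdistinct
  obtain ⟨x, y, z, hxy, hyz, hs1, hp1, hm1⟩ := sort3 a b c
  obtain ⟨u, v, w, huv, hvw, hs2, hp2, hm2⟩ := sort3 d e f
  rw [← hm1, ← hm2]
  have hP1 : x * y * z = N := by omega
  have hP2 : u * v * w = N := by omega
  have hs : x + y + z = u + v + w := by omega
  have hcomp : ∀ s t : ℕ, s ∣ N → t ∣ N → s ∣ t ∨ t ∣ s := by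
    intro s t h1 h2
    rw [hpr] at h1 h2
    obtain ⟨i, -, rfl⟩ := (Nat.dvd_prime_pow hpp).1 h1
    obtain ⟨j, -, rfl⟩ := (Nat.dvd_prime_pow hpp).1 h2
    rcases le_total i j with h | h
    · exact Or.inl (pow_dvd_pow p h)
    · exact Or.inr (pow_dvd_pow p h)
  have dy : y ∣ N := ⟨x * z, by rw [← hP1]; ring⟩
  have dz : z ∣ N := ⟨x * y, by rw [← hP1]; ring⟩
  have du : u ∣ N := ⟨v * w, by rw [← hP2]; ring⟩
  have dv : v ∣ N := ⟨u * w, by rw [← hP2]; ring⟩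
  have dw : w ∣ N := ⟨u * v, by rw [← hP2]; ring⟩
  have dx : x ∣ N := ⟨y * z, by rw [← hP1]; ring⟩
  have px := Nat.pos_of_dvd_of_pos dx hN
  have py := Nat.pos_of_dvd_of_pos dy hN
  have pz := Nat.pos_of_dvd_of_pos dz hN
  have pu := Nat.pos_of_dvd_of_pos du hN
  have pv := Nat.pos_of_dvd_of_pos dv hN
  have pw := Nat.pos_of_dvd_of_pos dw hN
  have l1 := largest_part_le x y z u v w pu pv pz hxy hyz hs (hP1.trans hP2.symm)
    (hcomp _ _ dy dz) (hcomp _ _ dz dw) pw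
  have l2 := largest_part_le u v w x y z px py pw huv hvw hs.symm (hP2.trans hP1.symm)
    (hcomp _ _ dv dw) (hcomp _ _ dw dz) pz
  have hzw : z = w := le_antisymm l2 l1
  subst hzw
  have hq : x * y = u * v := Nat.eq_of_mul_eq_mul_right pz (hP1.trans hP2.symm)
  have hxu : x = u := by
    have h1 := pair_not_lt x y u v huv (by omega) hq
    have h2 := pair_not_lt u v x y hxy (by omega) hq.symm
    omega
  have hyv : y = v := by omega
  rw [hxu, hyv]
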